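/- Let λ ≥ 0, let Z be a random variable with the Poisson distribution of parameter λ, and let f : ℕ → ℝ be a bounded function. Then for every n ∈ ℕ, E[f(Z) · (Z − λ)^n] = ∑_{c=0}^n (−1)^c · C(n,c) · λ^c · ∑_{k=0}^{n−c} λ^k · S(n−c, k) · E[f(Z+k)], where C(n,c) is the binomial coefficient and S(n,k) denotes the Stirling number of the second kind. -/

import Mathlib

open MeasureTheory Finset

/-- Stirling number of the second kind: the number of partitions of a set of `n`
elements into `k` non-empty subsets. -/
noncomputable def stirling2 (n k : ℕ) : ℕ :=
  Nat.card {P : Finpartition (Finset.univ : Finset (Fin n)) // P.parts.card = k}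

open ProbabilityTheory in
/-- A probability law on `ℕ` with Poisson weights is the Poisson measure. -/
theorem map_eq_poissonMeasure {Ω : Type*} [MeasurableSpace Ω] {μ : Measure Ω} {r : NNReal}
    {Z : Ω → ℕ} (hZ : Measurable Z)
    (hdist : ∀ m : ℕ, μ {ω | Z ω = m} =
      ENNReal.ofReal (Real.exp (-r) * (r : ℝ) ^ m / Nat.factorial m)) :
    μ.map Z = poissonMeasure r := by
  refine Measure.ext_of_singleton fun m => ?_
  rw [Measure.map_apply hZ (measurableSet_singleton m), poissonMeasure_singleton, ← hdist]
  rfl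

/-- A partition of `α` together with an injective labelling of its parts by `β` amounts to a
function `α → β`. -/
theorem bijective_sigma_finpartition_embedding (α β : Type*) [Fintype α] [DecidableEq α] :
    Function.Bijective fun (p : Σ P : Finpartition (univ : Finset α), (P.parts ↪ β)) (x : α) =>
      p.2 ⟨p.1.part x, p.1.part_mem.2 (mem_univ x)⟩ := by
  classical
  constructor
  · rintro ⟨P, e⟩ ⟨Q, e'⟩ h
    have h' : ∀ x, e ⟨P.part x, P.part_mem.2 (mem_univ x)⟩ =
        e' ⟨Q.part x, Q.part_mem.2 (mem_univ x)⟩ := fun x => congrFun h x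
    have hpart : ∀ y, P.part y = Q.part y := by
      intro y
      ext x
      rw [P.mem_part_iff_part_eq_part (mem_univ x) (mem_univ y),
        Q.mem_part_iff_part_eq_part (mem_univ x) (mem_univ y)]
      have h₁ := e.injective.eq_iff (a := ⟨P.part x, P.part_mem.2 (mem_univ x)⟩)
        (b := ⟨P.part y, P.part_mem.2 (mem_univ y)⟩)
      have h₂ := e'.injective.eq_iff (a := ⟨Q.part x, Q.part_mem.2 (mem_univ x)⟩)
        (b := ⟨Q.part y, Q.part_mem.2 (mem_univ y)⟩)
      rw [h' x, h' y, h₂] at h₁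
      simpa using h₁.symm
    have hPQ : P = Q := by
      ext t
      constructor
      · intro ht
        obtain ⟨x, -, rfl⟩ := P.part_surjOn ht
        exact hpart x ▸ Q.part_mem.2 (mem_univ x)
      · intro ht
        obtain ⟨x, -, rfl⟩ := Q.part_surjOn ht
        exact hpart x ▸ P.part_mem.2 (mem_univ x)
    subst hPQ
    congr 1
    ext ⟨t, ht⟩
    obtain ⟨x, -, rfl⟩ := P.part_surjOn ht
    exact h' x
  · intro g
    let P := Finpartition.ofSetoid (Setoid.ker g)
    have hP : ∀ {x y}, y ∈ P.part x ↔ g x = g y := Finpartition.mem_part_ofSetoid_iff_rel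
    have hex : ∀ t : P.parts, ∃ x, P.part x = t := fun t =>
      let ⟨x, _, hx⟩ := P.part_surjOn t.2
      ⟨x, hx⟩
    choose s hs using hex
    refine ⟨⟨P, fun t => g (s t), fun t u htu => ?_⟩, ?_⟩
    · apply Subtype.ext
      rw [← hs t, ← hs u, ← P.mem_part_iff_part_eq_part (mem_univ _) (mem_univ _), hP]
      exact htu.symm
    · funext x
      refine hP.1 ?_
      rw [P.mem_part_iff_part_eq_part (mem_univ _) (mem_univ _)]
      exact (hs ⟨P.part x, P.part_mem.2 (mem_univ x)⟩).symm

theorem pow_eq_sum_stirling2_mul_descFactorial (m n : ℕ) :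
    m ^ n = ∑ k ∈ range (n + 1), stirling2 n k * m.descFactorial k := by
  classical
  have h := Fintype.card_of_bijective (bijective_sigma_finpartition_embedding (Fin n) (Fin m))
  simp only [Fintype.card_sigma, Fintype.card_embedding_eq, Fintype.card_fun, Fintype.card_fin,
    Fintype.card_coe] at h
  rw [← h, ← sum_fiberwise_of_maps_to (t := range (n + 1)) (g := fun P => #P.parts)]
  · refine sum_congr rfl fun k _ => ?_
    rw [sum_congr rfl fun P hP => by rw [(mem_filter.1 hP).2], sum_const, smul_eq_mul, stirling2,
      Nat.card_eq_fintype_card, Fintype.card_subtype]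
  · intro P _
    simpa [Nat.lt_succ_iff] using P.card_parts_le_card

open ProbabilityTheory in
/-- The factorial moments of the Poisson distribution with a weight: `λ ^ k` times a shift. -/
theorem integrable_and_integral_mul_descFactorial_poissonMeasure (r : NNReal) {f : ℕ → ℝ}
    (hf : ∃ C, ∀ m, |f m| ≤ C) (k : ℕ) :
    Integrable (fun m => f m * (m.descFactorial k : ℝ)) (poissonMeasure r) ∧
      ∫ m, f m * (m.descFactorial k : ℝ) ∂poissonMeasure r =
        (r : ℝ) ^ k * ∫ m, f (m + k) ∂poissonMeasure r := by
  obtain ⟨C, hC⟩ := hf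
  have hshift : Integrable (fun m => f (m + k)) (poissonMeasure r) :=
    .of_bound .of_discrete C (ae_of_all _ fun m => hC _)
  have hw : ∀ m : ℕ, Real.exp (-r) * (r : ℝ) ^ (m + k) / (m + k).factorial *
      ((m + k).descFactorial k : ℝ) = (r : ℝ) ^ k * (Real.exp (-r) * (r : ℝ) ^ m / m.factorial) := by
    intro m
    have h : ((m + k).factorial : ℝ) = m.factorial * (m + k).descFactorial k := by
      have := Nat.factorial_mul_descFactorial (Nat.le_add_left k m)
      rw [Nat.add_sub_cancel] at this
      exact_mod_cast this.symm
    have h₀ : ((m + k).descFactorial k : ℝ) ≠ 0 := by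
      intro h'
      rw [h', mul_zero] at h
      exact Nat.cast_ne_zero.2 (Nat.factorial_ne_zero _) h
    rw [h, pow_add]
    field_simp
  have hzero : ∀ m ∉ Set.range (· + k), m.descFactorial k = 0 := by
    intro m hm
    rw [Nat.descFactorial_eq_zero_iff_lt]
    by_contra! hkm
    exact hm ⟨m - k, Nat.sub_add_cancel hkm⟩
  constructor
  · rw [integrable_poissonMeasure_iff] at hshift ⊢
    rw [← (add_left_injective k).summable_iff fun m hm => by simp [hzero m hm]]
    refine (hshift.mul_left ((r : ℝ) ^ k)).congr fun m => ?_
    simp only [Function.comp_apply, norm_mul, RCLike.norm_natCast]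
    linear_combination -‖f (m + k)‖ * hw m
  · rw [integral_poissonMeasure, integral_poissonMeasure, ← tsum_mul_left,
      ← (add_left_injective k).tsum_eq]
    · refine tsum_congr fun m => ?_
      simp only [smul_eq_mul]
      linear_combination f (m + k) * hw m
    · rw [Function.support_subset_iff']
      intro m hm
      simp [hzero m hm]

theorem stmt9 {Ω : Type*} [MeasurableSpace Ω] (μ : Measure Ω) [IsProbabilityMeasure μ]
    (lam : ℝ) (hlam : 0 ≤ lam) (Z : Ω → ℕ) (hZ : Measurable Z)
    (hdist : ∀ m : ℕ, μ {ω | Z ω = m} =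
      ENNReal.ofReal (Real.exp (-lam) * lam ^ m / Nat.factorial m))
    (f : ℕ → ℝ) (hf : ∃ C, ∀ m, |f m| ≤ C) (n : ℕ) :
    ∫ ω, f (Z ω) * ((Z ω : ℝ) - lam) ^ n ∂μ =
      ∑ c ∈ Finset.range (n + 1), (-1 : ℝ) ^ c * (n.choose c : ℝ) * lam ^ c *
        ∑ k ∈ Finset.range (n - c + 1),
          lam ^ k * (stirling2 (n - c) k : ℝ) * ∫ ω, f (Z ω + k) ∂μ := by
  lift lam to NNReal using hlam
  have hint : ∀ g : ℕ → ℝ, ∫ ω, g (Z ω) ∂μ = ∫ m, g m ∂ProbabilityTheory.poissonMeasure lam :=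
    fun g => by rw [← map_eq_poissonMeasure hZ hdist, integral_map hZ.aemeasurable .of_discrete]
  have key := integrable_and_integral_mul_descFactorial_poissonMeasure lam hf
  have hexpand : ∀ m : ℕ, f m * ((m : ℝ) - lam) ^ n =
      ∑ c ∈ range (n + 1), ∑ k ∈ range (n - c + 1),
        ((-1 : ℝ) ^ c * (n.choose c : ℝ) * (lam : ℝ) ^ c * (stirling2 (n - c) k : ℝ)) *
          (f m * (m.descFactorial k : ℝ)) := by
    intro m
    rw [sub_eq_neg_add, add_pow, mul_sum]
    refine sum_congr rfl fun c _ => ?_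
    have h : (m : ℝ) ^ (n - c) =
        ∑ k ∈ range (n - c + 1), (stirling2 (n - c) k : ℝ) * (m.descFactorial k : ℝ) := by
      exact_mod_cast pow_eq_sum_stirling2_mul_descFactorial m (n - c)
    rw [h, neg_pow, mul_sum, sum_mul, mul_sum]
    exact sum_congr rfl fun k _ => by ring
  rw [hint fun m => f m * ((m : ℝ) - lam) ^ n]
  simp only [hexpand]
  rw [integral_finsetSum _ fun c _ => integrable_finsetSum _ fun k _ => (key k).1.const_mul _]
  refine sum_congr rfl fun c _ => ?_
  rw [integral_finsetSum _ fun k _ => (key k).1.const_mul _, mul_sum]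
  refine sum_congr rfl fun k _ => ?_
  rw [integral_const_mul, (key k).2, hint fun m => f (m + k)]
  ring
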